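/- arXiv:1803.09623 — 2 statements merged into one kernel-verified Lean document; each statement's English description precedes it below -/
import Mathlib

section
/- For every rooted tree T, 𝒫(T;x,y) = Σ_{A∈𝒜(T)} x^{ℓ(A)}·y^{s(A)}, where 𝒜(T) is the set of all maximal antichains of T. -/
/-- A rooted tree: a root together with a list of branches. -/
inductive RTree : Type
  | node : List RTree → RTree

namespace RTree

/-- Number of vertices of a rooted tree. -/
def size : RTree → ℕ
  | node ts => 1 + (ts.attach.map fun t => t.1.size).sum
decreasing_by
  have := List.sizeOf_lt_of_mem t.2
  simp only [node.sizeOf_spec]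
  omega

/-- The Tutte-like polynomial `𝒫(T; x, y)`, evaluated at integers `x, y`. -/
def pol : RTree → ℤ → ℤ → ℤ
  | node ts, x, y =>
    if ts.isEmpty then x
    else (ts.attach.map fun t => pol t.1 x y).prod + y ^ ((node ts).size - 1)
decreasing_by
  have := List.sizeOf_lt_of_mem t.2
  simp only [node.sizeOf_spec]
  omega

/-- The subtree of `T` rooted at the vertex reached by following the path `p`
of child indices from the root, if such a vertex exists. -/
def subtree? : RTree → List ℕ → Option RTree
  | t, [] => some t
  | node ts, i :: p => (ts[i]?).bind fun t => subtree? t p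

/-- `p` is a vertex of `T` (vertices are identified with the paths of child
indices leading to them from the root). -/
def IsVertex (T : RTree) (p : List ℕ) : Prop := (T.subtree? p).isSome

/-- `p` is a leaf of `T`: a vertex with no children. -/
def IsLeaf (T : RTree) (p : List ℕ) : Prop := T.subtree? p = some (node [])

/-- `A` is an antichain of `T`: a set of vertices no two of which lie on a common
path from the root, i.e. no element of `A` is an ancestor (= path-prefix) of
another. -/
def IsAntichainIn (T : RTree) (A : Finset (List ℕ)) : Prop :=
  (∀ p ∈ A, T.IsVertex p) ∧ ∀ p ∈ A, ∀ q ∈ A, p ≠ q → ¬ p <+: q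

/-- `A` is a maximal antichain of `T`: an antichain that is not a proper subset of
another antichain. -/
def IsMaxAntichainIn (T : RTree) (A : Finset (List ℕ)) : Prop :=
  T.IsAntichainIn A ∧ ∀ B : Finset (List ℕ), T.IsAntichainIn B → A ⊆ B → A = B

/-- `ℓ(A)`: the number of leaves of `T` contained in `A`. -/
noncomputable def leafCount (T : RTree) (A : Finset (List ℕ)) : ℕ :=
  {p ∈ (A : Set (List ℕ)) | T.IsLeaf p}.ncard

/-- The number of vertices of the subtree `T_p` of `T` rooted at the vertex `p`
(and `0` if `p` is not a vertex). -/
def subSize (T : RTree) (p : List ℕ) : ℕ := ((T.subtree? p).map size).getD 0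

/-- `s(A) = ∑_{a ∈ A} (|T_a| − 1)`: the number of vertices strictly below `A`. -/
def succCount (T : RTree) (A : Finset (List ℕ)) : ℕ := ∑ p ∈ A, (T.subSize p - 1)

end RTree

namespace RTree

/-- Induction on rooted trees through the branches at the root. -/
theorem branch_induction {P : RTree → Prop}
    (h : ∀ ts : List RTree, (∀ t ∈ ts, P t) → P (node ts)) : ∀ T, P T
  | node ts => h ts fun t _ => branch_induction h t
decreasing_by
  have := List.sizeOf_lt_of_mem ‹_›
  simp only [node.sizeOf_spec]
  omega

theorem subtree?_nil (T : RTree) : T.subtree? [] = some T := by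
  cases T; simp [subtree?]

theorem subtree?_node_cons (ts : List RTree) (i : Fin ts.length) (p : List ℕ) :
    (node ts).subtree? ((i : ℕ) :: p) = ts[(i : ℕ)].subtree? p := by
  simp [subtree?]

theorem isVertex_nil (T : RTree) : T.IsVertex [] := by
  simp [IsVertex, subtree?_nil]

theorem isVertex_node_cons (ts : List RTree) (i : Fin ts.length) (p : List ℕ) :
    (node ts).IsVertex ((i : ℕ) :: p) ↔ ts[(i : ℕ)].IsVertex p := by
  rw [IsVertex, subtree?_node_cons, IsVertex]

theorem IsVertex.exists_eq_cons {ts : List RTree} {p : List ℕ} (hp : (node ts).IsVertex p)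
    (hne : p ≠ []) : ∃ (i : Fin ts.length) (q : List ℕ),
      p = (i : ℕ) :: q ∧ ts[(i : ℕ)].IsVertex q := by
  cases p with
  | nil => exact absurd rfl hne
  | cons i q =>
    by_cases hi : i < ts.length
    · exact ⟨⟨i, hi⟩, q, rfl, (isVertex_node_cons ts ⟨i, hi⟩ q).1 hp⟩
    · simp [IsVertex, subtree?, List.getElem?_eq_none (Nat.le_of_not_lt hi)] at hp

/-- An antichain is maximal iff every vertex is comparable to one of its elements. -/
theorem isMaxAntichainIn_iff (T : RTree) (A : Finset (List ℕ)) :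
    T.IsMaxAntichainIn A ↔
      T.IsAntichainIn A ∧ ∀ p, T.IsVertex p → ∃ q ∈ A, p <+: q ∨ q <+: p := by
  refine ⟨fun h => ⟨h.1, fun p hp => ?_⟩, fun h => ⟨h.1, fun B hB hAB => ?_⟩⟩
  · by_contra! hc
    have hpA : p ∈ A := by
      rw [h.2 (insert p A) ⟨?_, ?_⟩ (Finset.subset_insert p A)]
      · exact Finset.mem_insert_self p A
      · intro q hq
        rcases Finset.mem_insert.1 hq with rfl | hq
        exacts [hp, h.1.1 q hq]
      · intro a ha b hb hab
        rcases Finset.mem_insert.1 ha with rfl | ha' <;>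
          rcases Finset.mem_insert.1 hb with rfl | hb'
        exacts [absurd rfl hab, (hc b hb').1, (hc a ha').2, h.1.2 a ha' b hb' hab]
    exact (hc p hpA).1 (List.prefix_refl p)
  · refine hAB.antisymm fun p hp => ?_
    obtain ⟨q, hq, hpq⟩ := h.2 p (hB.1 p hp)
    by_contra hpA
    have hne : p ≠ q := fun e => hpA (e ▸ hq)
    rcases hpq with hpq | hpq
    exacts [hB.2 p hp q (hAB hq) hne hpq, hB.2 q (hAB hq) p hp hne.symm hpq]

theorem isMaxAntichainIn_singleton_nil (T : RTree) : T.IsMaxAntichainIn {[]} := by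
  rw [isMaxAntichainIn_iff]
  refine ⟨⟨by simpa using T.isVertex_nil, by simp +contextual⟩, fun p _ => ⟨[], by simp⟩⟩

theorem IsAntichainIn.eq_singleton_nil {T : RTree} {A : Finset (List ℕ)}
    (hA : T.IsAntichainIn A) (h : [] ∈ A) : A = {[]} := by
  refine Finset.eq_singleton_iff_unique_mem.2 ⟨h, fun p hp => ?_⟩
  by_contra hne
  exact hA.2 [] h p hp (Ne.symm hne) (by simp)

/-- The set of paths whose first index is `i` and whose remainder lies in `g i`, for some `i`. -/
def glue {n : ℕ} (g : Fin n → Finset (List ℕ)) : Finset (List ℕ) :=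
  Finset.univ.biUnion fun i => (g i).map ⟨List.cons (i : ℕ), List.cons_injective⟩

theorem mem_glue {n : ℕ} {g : Fin n → Finset (List ℕ)} {p : List ℕ} :
    p ∈ glue g ↔ ∃ i : Fin n, ∃ q ∈ g i, (i : ℕ) :: q = p := by
  simp [glue]

theorem nil_notMem_glue {n : ℕ} (g : Fin n → Finset (List ℕ)) : [] ∉ glue g := by
  simp [mem_glue]

theorem cons_mem_glue {n : ℕ} {g : Fin n → Finset (List ℕ)} {i : Fin n} {q : List ℕ} :
    (i : ℕ) :: q ∈ glue g ↔ q ∈ g i := by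
  rw [mem_glue]
  constructor
  · rintro ⟨j, r, hr, h⟩
    obtain ⟨hj, rfl⟩ := List.cons.inj h
    rwa [← Fin.ext hj]
  · exact fun h => ⟨i, q, h, rfl⟩

theorem glue_injective (n : ℕ) :
    Function.Injective (glue : (Fin n → Finset (List ℕ)) → Finset (List ℕ)) := by
  intro g h e
  ext i q
  rw [← cons_mem_glue, e, cons_mem_glue]

theorem sum_glue {n : ℕ} (g : Fin n → Finset (List ℕ)) (f : List ℕ → ℕ) :
    ∑ p ∈ glue g, f p = ∑ i, ∑ q ∈ g i, f ((i : ℕ) :: q) := by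
  rw [glue, Finset.sum_biUnion]
  · simp
  · intro i _ j _ hij
    rw [Function.onFun, Finset.disjoint_left]
    intro p hi hj
    simp only [Finset.mem_map, Function.Embedding.coeFn_mk] at hi hj
    obtain ⟨q, -, rfl⟩ := hi
    obtain ⟨r, -, h⟩ := hj
    exact hij (Fin.ext (List.cons.inj h).1.symm)

open scoped Classical in
theorem leafCount_eq_sum (T : RTree) (A : Finset (List ℕ)) :
    T.leafCount A = ∑ p ∈ A, if T.IsLeaf p then 1 else 0 := by
  rw [← Finset.card_filter, leafCount, ← Set.ncard_coe_finset]
  congr 1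
  ext p
  simp

theorem leafCount_glue (ts : List RTree) (g : Fin ts.length → Finset (List ℕ)) :
    (node ts).leafCount (glue g) = ∑ i : Fin ts.length, ts[(i : ℕ)].leafCount (g i) := by
  classical
  simp only [leafCount_eq_sum, sum_glue]
  refine Finset.sum_congr rfl fun i _ => Finset.sum_congr rfl fun p _ => if_congr ?_ rfl rfl
  rw [IsLeaf, subtree?_node_cons, IsLeaf]

theorem succCount_glue (ts : List RTree) (g : Fin ts.length → Finset (List ℕ)) :
    (node ts).succCount (glue g) = ∑ i : Fin ts.length, ts[(i : ℕ)].succCount (g i) := by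
  simp only [succCount, sum_glue, subSize, subtree?_node_cons]

theorem isAntichainIn_glue (ts : List RTree) (g : Fin ts.length → Finset (List ℕ)) :
    (node ts).IsAntichainIn (glue g) ↔ ∀ i : Fin ts.length, ts[(i : ℕ)].IsAntichainIn (g i) := by
  constructor
  · refine fun h i => ⟨fun p hp => ?_, fun p hp q hq hne hpq => ?_⟩
    · exact (isVertex_node_cons ts i p).1 (h.1 _ (cons_mem_glue.2 hp))
    · exact h.2 _ (cons_mem_glue.2 hp) _ (cons_mem_glue.2 hq) (by simpa using hne)
        (by simpa using hpq)
  · refine fun h => ⟨fun p hp => ?_, fun p hp q hq hne hpq => ?_⟩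
    · obtain ⟨i, p, hp', rfl⟩ := mem_glue.1 hp
      exact (isVertex_node_cons ts i p).2 ((h i).1 p hp')
    · obtain ⟨i, p, hp', rfl⟩ := mem_glue.1 hp
      obtain ⟨j, q, hq', rfl⟩ := mem_glue.1 hq
      obtain ⟨hij, hpq'⟩ := List.cons_prefix_cons.1 hpq
      obtain rfl := Fin.ext hij
      exact (h i).2 p hp' q hq' (by simpa using hne) hpq'

theorem isMaxAntichainIn_glue {ts : List RTree} (hts : ts ≠ [])
    (g : Fin ts.length → Finset (List ℕ)) :
    (node ts).IsMaxAntichainIn (glue g) ↔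
      ∀ i : Fin ts.length, ts[(i : ℕ)].IsMaxAntichainIn (g i) := by
  simp only [isMaxAntichainIn_iff, isAntichainIn_glue, forall_and]
  refine and_congr_right fun _ => ⟨fun h i p hp => ?_, fun h p hp => ?_⟩
  · obtain ⟨q, hq, hpq⟩ := h _ ((isVertex_node_cons ts i p).2 hp)
    obtain ⟨j, q, hq', rfl⟩ := mem_glue.1 hq
    have hij : i = j := by
      rcases hpq with hpq | hpq
      exacts [Fin.ext (List.cons_prefix_cons.1 hpq).1, Fin.ext (List.cons_prefix_cons.1 hpq).1.symm]
    subst hij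
    exact ⟨q, hq', by simpa using hpq⟩
  · by_cases hne : p = []
    · subst hne
      let i : Fin ts.length := ⟨0, List.length_pos_of_ne_nil hts⟩
      obtain ⟨q, hq, -⟩ := h i [] (isVertex_nil _)
      exact ⟨_, cons_mem_glue.2 hq, Or.inl (by simp)⟩
    · obtain ⟨i, p, rfl, hp'⟩ := hp.exists_eq_cons hne
      obtain ⟨q, hq, hpq⟩ := h i p hp'
      exact ⟨_, cons_mem_glue.2 hq, by simpa using hpq⟩

theorem IsAntichainIn.exists_eq_glue {ts : List RTree} {A : Finset (List ℕ)}
    (hA : (node ts).IsAntichainIn A) (h : [] ∉ A) :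
    ∃ g : Fin ts.length → Finset (List ℕ), A = glue g := by
  refine ⟨fun i => A.preimage (List.cons (i : ℕ)) List.cons_injective.injOn, ?_⟩
  ext p
  by_cases hp : p = []
  · subst hp
    simp [h, nil_notMem_glue]
  · constructor
    · intro hpA
      obtain ⟨i, q, rfl, -⟩ := (hA.1 p hpA).exists_eq_cons hp
      exact cons_mem_glue.2 (by simpa using hpA)
    · intro hpg
      obtain ⟨i, q, hq, rfl⟩ := mem_glue.1 hpg
      simpa using hq

theorem isMaxAntichainIn_leaf (A : Finset (List ℕ)) :
    (node []).IsMaxAntichainIn A ↔ A = {[]} := by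
  refine ⟨fun h => ?_, fun h => h ▸ isMaxAntichainIn_singleton_nil _⟩
  refine (h.2 {[]} (isMaxAntichainIn_singleton_nil _).1 fun p hp => ?_)
  by_contra hne
  obtain ⟨i, -⟩ := (h.1.1 p hp).exists_eq_cons (by simpa using hne)
  exact i.elim0

theorem isMaxAntichainIn_node {ts : List RTree} (hts : ts ≠ []) (A : Finset (List ℕ)) :
    (node ts).IsMaxAntichainIn A ↔ A = {[]} ∨ ∃ g : Fin ts.length → Finset (List ℕ),
      (∀ i : Fin ts.length, ts[(i : ℕ)].IsMaxAntichainIn (g i)) ∧ glue g = A := by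
  constructor
  · intro h
    by_cases hnil : [] ∈ A
    · exact Or.inl (h.1.eq_singleton_nil hnil)
    · obtain ⟨g, rfl⟩ := h.1.exists_eq_glue hnil
      exact Or.inr ⟨g, (isMaxAntichainIn_glue hts g).1 h, rfl⟩
  · rintro (rfl | ⟨g, hg, rfl⟩)
    exacts [isMaxAntichainIn_singleton_nil _, (isMaxAntichainIn_glue hts g).2 hg]

theorem leafCount_singleton_nil_leaf : (node []).leafCount {[]} = 1 := by
  classical
  simp [leafCount_eq_sum, IsLeaf, subtree?_nil]

theorem leafCount_singleton_nil {ts : List RTree} (hts : ts ≠ []) :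
    (node ts).leafCount {[]} = 0 := by
  classical
  simp [leafCount_eq_sum, IsLeaf, subtree?_nil, hts]

theorem succCount_singleton_nil (T : RTree) : T.succCount {[]} = T.size - 1 := by
  simp [succCount, subSize, subtree?_nil]

theorem pol_leaf (x y : ℤ) : (node []).pol x y = x := by
  simp [pol]

theorem pol_node {ts : List RTree} (hts : ts ≠ []) (x y : ℤ) :
    (node ts).pol x y =
      ∏ i : Fin ts.length, ts[(i : ℕ)].pol x y + y ^ ((node ts).size - 1) := by
  rw [pol, Fin.prod_univ_fun_getElem ts fun t => t.pol x y]
  simp [hts]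

theorem exists_finset_pol_eq_sum (x y : ℤ) (T : RTree) :
    ∃ S : Finset (Finset (List ℕ)), (∀ A, A ∈ S ↔ T.IsMaxAntichainIn A) ∧
      T.pol x y = ∑ A ∈ S, x ^ T.leafCount A * y ^ T.succCount A := by
  induction T using branch_induction with
  | h ts ih =>
    by_cases hts : ts = []
    · subst hts
      refine ⟨{{[]}}, fun A => by rw [isMaxAntichainIn_leaf, Finset.mem_singleton], ?_⟩
      rw [Finset.sum_singleton, leafCount_singleton_nil_leaf, succCount_singleton_nil, pol_leaf]
      simp [size]
    · have ih' (i : Fin ts.length) := ih ts[(i : ℕ)] (List.getElem_mem i.2)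
      choose S hS hpol using ih'
      have hnotMem : {[]} ∉ (Fintype.piFinset S).image glue := by
        intro h
        obtain ⟨g, -, hg⟩ := Finset.mem_image.1 h
        exact nil_notMem_glue g (hg ▸ Finset.mem_singleton_self [])
      refine ⟨insert {[]} ((Fintype.piFinset S).image glue), fun A => ?_, ?_⟩
      · simp only [isMaxAntichainIn_node hts, Finset.mem_insert, Finset.mem_image,
          Fintype.mem_piFinset, hS]
      · rw [Finset.sum_insert hnotMem, Finset.sum_image (glue_injective _).injOn,
          leafCount_singleton_nil hts, succCount_singleton_nil, pol_node hts, pow_zero, one_mul,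
          add_comm]
        simp only [hpol, Finset.prod_univ_sum, leafCount_glue, succCount_glue,
          Finset.prod_mul_distrib, Finset.prod_pow_eq_pow_sum]

end RTree

/-- For every rooted tree `T`,
`𝒫(T;x,y) = Σ_{A ∈ 𝒜(T)} x^{ℓ(A)} · y^{s(A)}`, the sum being over all maximal
antichains `A` of `T`. -/
theorem pol_eq_sum_maxAntichains (T : RTree) (x y : ℤ) :
    T.pol x y =
      ∑ᶠ A ∈ {A : Finset (List ℕ) | T.IsMaxAntichainIn A},
        x ^ T.leafCount A * y ^ T.succCount A := by
  obtain ⟨S, hS, hpol⟩ := RTree.exists_finset_pol_eq_sum x y T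
  have hset : {A : Finset (List ℕ) | T.IsMaxAntichainIn A} = S := by
    ext A
    simp [hS]
  rw [hset, finsum_mem_coe_finset, hpol]
end

section
/- In every nonempty 𝒱-poset, the set of basic elements is a maximal antichain. -/
/-- The order relation of the disjoint union of two ordered sets. -/
def sumRel {α β : Type} (r : α → α → Prop) (s : β → β → Prop) :
    α ⊕ β → α ⊕ β → Prop
  | Sum.inl a, Sum.inl a' => r a a'
  | Sum.inr b, Sum.inr b' => s b b'
  | _, _ => False

/-- The order relation obtained from `r` by adding a new greatest element
(represented by `none`). -/
def addTopRel {α : Type} (r : α → α → Prop) : Option α → Option α → Prop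
  | _, none => True
  | none, some _ => False
  | some a, some b => r a b

/-- The order relation obtained from `r` by adding a new least element
(represented by `none`). -/
def addBotRel {α : Type} (r : α → α → Prop) : Option α → Option α → Prop
  | none, _ => True
  | some _, none => False
  | some a, some b => r a b

/-- The relations (on arbitrary carrier types) that arise from the empty order by
repeatedly taking disjoint unions and adding a new greatest or least element;
the class is closed under relabelling along bijections. -/
inductive IsVRel : (α : Type) → (α → α → Prop) → Prop
  | empty (α : Type) (r : α → α → Prop) (h : IsEmpty α) : IsVRel α r
  | union {α β : Type} {r : α → α → Prop} {s : β → β → Prop} :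
      IsVRel α r → IsVRel β s → IsVRel (α ⊕ β) (sumRel r s)
  | addTop {α : Type} {r : α → α → Prop} : IsVRel α r → IsVRel (Option α) (addTopRel r)
  | addBot {α : Type} {r : α → α → Prop} : IsVRel α r → IsVRel (Option α) (addBotRel r)
  | congr {α β : Type} {r : α → α → Prop} {s : β → β → Prop} (e : α ≃ β)
      (he : ∀ a b : α, r a b ↔ s (e a) (e b)) : IsVRel α r → IsVRel β s

/-- A partially ordered set is a `𝒱`-poset if it can be built from the empty poset
by repeatedly taking disjoint unions and adding new greatest or least elements. -/
def IsVPoset (α : Type) [PartialOrder α] : Prop :=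
  IsVRel α (· ≤ ·)

section Basic

variable {α : Type} [PartialOrder α]

/-- Two elements of a poset are incomparable. -/
def Incomp (u v : α) : Prop := ¬(u ≤ v ∨ v ≤ u)

/-- An element `x` of a poset is basic if (B1) there are no two incomparable
elements `u, v` with `x > u` and `x > v`; (B2) there are no two incomparable
elements `u, v` with `x < u` and `x < v`; and (B3) there is no `u < x` such that
every element `w ≠ u, x` satisfies `(u ≥ w ↔ x ≥ w)` and `(u ≤ w ↔ x ≤ w)`. -/
def IsBasic (x : α) : Prop :=
  (¬∃ u v : α, Incomp u v ∧ u < x ∧ v < x) ∧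
  (¬∃ u v : α, Incomp u v ∧ x < u ∧ x < v) ∧
  ¬∃ u : α, u < x ∧ ∀ w : α, w ≠ u → w ≠ x →
    ((w ≤ u ↔ w ≤ x) ∧ (u ≤ w ↔ x ≤ w))

end Basic

/-- `s` is a maximal antichain of a poset: an antichain that is not a proper
subset of another antichain. -/
def IsMaxAntichainSet {α : Type} [PartialOrder α] (s : Set α) : Prop :=
  IsAntichain (· ≤ ·) s ∧ ∀ t : Set α, IsAntichain (· ≤ ·) t → s ⊆ t → s = t

/-- `IsBasic` for the order relation `r`, without a bundled partial order. -/
def RelBasic {α : Type} (r : α → α → Prop) (x : α) : Prop :=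
  (∀ u v, r u x → ¬r x u → r v x → ¬r x v → r u v ∨ r v u) ∧
  (∀ u v, r x u → ¬r u x → r x v → ¬r v x → r u v ∨ r v u) ∧
  ∀ u, r u x → ¬r x u → ∃ w, w ≠ u ∧ w ≠ x ∧ ¬((r w u ↔ r w x) ∧ (r u w ↔ r x w))

theorem isBasic_iff_relBasic {α : Type} [PartialOrder α] (x : α) :
    IsBasic x ↔ RelBasic (· ≤ ·) x := by
  simp only [IsBasic, RelBasic, Incomp, lt_iff_le_not_ge]
  grind

/-- `r` is a partial order on a finite type whose basic elements form an antichain and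
such that every element is comparable to a basic one. -/
structure BasicMaxAntichain {α : Type} (r : α → α → Prop) : Prop where
  finite : Finite α
  refl : ∀ a, r a a
  trans : ∀ a b c, r a b → r b c → r a c
  antisymm : ∀ a b, r a b → r b a → a = b
  antichain : ∀ a b, RelBasic r a → RelBasic r b → r a b → a = b
  exists_comparable : ∀ a, ∃ b, RelBasic r b ∧ (r a b ∨ r b a)

theorem BasicMaxAntichain.exists_maximal {α : Type} {r : α → α → Prop}
    (h : BasicMaxAntichain r) {p : α → Prop} (hp : ∃ a, p a) :
    ∃ m, p m ∧ ∀ a, p a → r m a → a = m := by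
  have := h.finite
  let : PartialOrder α :=
    { le := r, le_refl := h.refl, le_trans := h.trans, le_antisymm := h.antisymm }
  obtain ⟨m, hm⟩ := (Set.toFinite {a | p a}).exists_maximal hp
  exact ⟨m, hm.1, fun a ha hma => (hm.eq_of_le ha hma).symm⟩

section Constructions

variable {α β : Type} {r : α → α → Prop} {s : β → β → Prop}

theorem relBasic_congr (e : α ≃ β) (he : ∀ a b, r a b ↔ s (e a) (e b)) (x : α) :
    RelBasic s (e x) ↔ RelBasic r x := by
  simp only [RelBasic, ← e.forall_congr_right (q := fun _ => _), ← e.exists_congr_right, he,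
    e.injective.ne_iff]

theorem relBasic_sum_inl (x : α) : RelBasic (sumRel r s) (Sum.inl x) ↔ RelBasic r x := by
  simp [RelBasic, sumRel]

theorem relBasic_sum_inr (x : β) : RelBasic (sumRel r s) (Sum.inr x) ↔ RelBasic s x := by
  simp [RelBasic, sumRel]

theorem relBasic_addTop_some (x : α) : RelBasic (addTopRel r) (some x) ↔ RelBasic r x := by
  simp [RelBasic, Option.forall, Option.exists, addTopRel]

theorem relBasic_addTop_none (h : BasicMaxAntichain r) :
    RelBasic (addTopRel r) none ↔ IsEmpty α := by
  constructor
  · rintro ⟨htot, -, htwin⟩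
    by_contra hne
    rw [not_isEmpty_iff] at hne
    obtain ⟨m, -, hm⟩ := h.exists_maximal (p := fun _ => True) ⟨hne.some, trivial⟩
    have htop : ∀ a, r a m := fun a => by
      rcases htot (some a) (some m) trivial id trivial id with hr | hr
      · exact hr
      · exact hm a trivial hr ▸ h.refl _
    have hw := htwin (some m) trivial id
    simp only [Option.exists, addTopRel] at hw
    obtain hw | ⟨w, hwm, -, hw⟩ := hw
    · exact hw.2.1 rfl
    · exact hw ⟨iff_of_true (htop w) trivial,
        iff_of_false (fun hmw => hwm (congrArg some (hm w trivial hmw))) id⟩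
  · intro hα
    simp [RelBasic, Option.forall, Option.exists, addTopRel]

theorem relBasic_addBot_none :
    RelBasic (addBotRel r) none ↔ ∀ a b, r a b ∨ r b a := by
  simp [RelBasic, Option.forall, addBotRel]

theorem relBasic_addBot_some (h : BasicMaxAntichain r) (x : α) :
    RelBasic (addBotRel r) (some x) ↔ RelBasic r x ∧ ¬∀ a, r x a := by
  have := h.antisymm
  have := h.refl
  simp [RelBasic, Option.forall, Option.exists, addBotRel]
  grind

theorem RelBasic.least_of_total (h : BasicMaxAntichain r) (htot : ∀ a b, r a b ∨ r b a)
    {x : α} (hx : RelBasic r x) (a : α) : r x a := by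
  by_contra hxa
  obtain ⟨m, ⟨hmx, hxm⟩, hm⟩ := h.exists_maximal (p := fun u => r u x ∧ ¬r x u)
    ⟨a, (htot x a).resolve_left hxa, hxa⟩
  obtain ⟨w, hwm, hwx, hw⟩ := hx.2.2 m hmx hxm
  have := h.trans
  have := h.antisymm
  grind

theorem BasicMaxAntichain.congr (e : α ≃ β) (he : ∀ a b, r a b ↔ s (e a) (e b))
    (h : BasicMaxAntichain r) : BasicMaxAntichain s := by
  have hfin := h.finite
  refine ⟨Finite.of_equiv α e, ?_, ?_, ?_, ?_, ?_⟩ <;>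
    simp only [e.surjective.forall, e.surjective.exists, ← he, relBasic_congr e he,
      e.apply_eq_iff_eq]
  exacts [h.refl, h.trans, h.antisymm, h.antichain, h.exists_comparable]

theorem BasicMaxAntichain.sum (hr : BasicMaxAntichain r) (hs : BasicMaxAntichain s) :
    BasicMaxAntichain (sumRel r s) := by
  have := hr.finite
  have := hs.finite
  refine ⟨inferInstance, ?_, ?_, ?_, ?_, ?_⟩ <;>
    simp only [Sum.forall, Sum.exists, relBasic_sum_inl, relBasic_sum_inr, sumRel]
  · exact ⟨hr.refl, hs.refl⟩
  · have := hr.trans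
    have := hs.trans
    grind
  · have := hr.antisymm
    have := hs.antisymm
    grind
  · have := hr.antichain
    have := hs.antichain
    grind
  · exact ⟨fun a => Or.inl (hr.exists_comparable a), fun b => Or.inr (hs.exists_comparable b)⟩

theorem BasicMaxAntichain.addTop (h : BasicMaxAntichain r) :
    BasicMaxAntichain (addTopRel r) := by
  have := h.finite
  refine ⟨inferInstance, ?_, ?_, ?_, ?_, ?_⟩ <;>
    simp only [Option.forall, Option.exists, relBasic_addTop_some, relBasic_addTop_none h,
      addTopRel]
  · exact ⟨trivial, h.refl⟩
  · have := h.trans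
    grind
  · have := h.antisymm
    grind
  · refine ⟨⟨fun _ _ _ => trivial, fun a hα => hα.elim a⟩, fun a => ⟨fun _ hα => hα.elim a, ?_⟩⟩
    exact fun b ha hb hab => congrArg some (h.antichain a b ha hb hab)
  · refine ⟨?_, fun a => Or.inr (h.exists_comparable a)⟩
    rcases isEmpty_or_nonempty α with hα | ⟨⟨a⟩⟩
    · exact Or.inl ⟨hα, Or.inl trivial⟩
    · obtain ⟨b, hb, -⟩ := h.exists_comparable a
      exact Or.inr ⟨b, hb, Or.inr trivial⟩

theorem BasicMaxAntichain.addBot (h : BasicMaxAntichain r) :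
    BasicMaxAntichain (addBotRel r) := by
  have := h.finite
  have hleast (htot : ∀ a b, r a b ∨ r b a) (x : α) (hx : RelBasic r x) : ∀ a, r x a :=
    hx.least_of_total h htot
  refine ⟨inferInstance, ?_, ?_, ?_, ?_, ?_⟩ <;>
    simp only [Option.forall, Option.exists, relBasic_addBot_some h, relBasic_addBot_none,
      addBotRel]
  · exact ⟨trivial, h.refl⟩
  · have := h.trans
    grind
  · have := h.antisymm
    grind
  · have := h.antichain
    grind
  · by_cases htot : ∀ a b, r a b ∨ r b a
    · simp [htot]
    · have hnot (x : α) (hx : RelBasic r x) : ¬∀ a, r x a := fun hxa => htot fun a b => by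
        by_cases hax : r a x
        · exact Or.inl (h.antisymm a x hax (hxa a) ▸ hxa b)
        by_cases hbx : r b x
        · exact Or.inr (h.antisymm b x hbx (hxa b) ▸ hxa a)
        exact hx.2.1 a b (hxa a) hax (hxa b) hbx
      refine ⟨?_, fun a => Or.inr ?_⟩
      · push Not at htot
        obtain ⟨a, -⟩ := htot
        obtain ⟨b, hb, -⟩ := h.exists_comparable a
        exact Or.inr ⟨b, ⟨hb, hnot b hb⟩, Or.inl trivial⟩
      · obtain ⟨b, hb, hab⟩ := h.exists_comparable a
        exact ⟨b, ⟨hb, hnot b hb⟩, hab⟩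

end Constructions

theorem IsVRel.basicMaxAntichain {α : Type} {r : α → α → Prop} (h : IsVRel α r) :
    BasicMaxAntichain r := by
  induction h with
  | empty α r h => constructor <;> first | infer_instance | exact fun a => h.elim a
  | union _ _ hr hs => exact hr.sum hs
  | addTop _ h => exact h.addTop
  | addBot _ h => exact h.addBot
  | congr e he _ h => exact h.congr e he

/-- In every nonempty (finite) `𝒱`-poset, the set of basic
elements is a maximal antichain. -/
theorem basic_isMaxAntichain (α : Type) [PartialOrder α] [Fintype α] [Nonempty α]
    (h : IsVPoset α) :
    IsMaxAntichainSet {x : α | IsBasic x} := by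
  have hα := IsVRel.basicMaxAntichain h
  refine ⟨fun a ha b hb hab hle => hab (hα.antichain a b ?_ ?_ hle), fun t ht hst => ?_⟩
  · exact (isBasic_iff_relBasic a).1 ha
  · exact (isBasic_iff_relBasic b).1 hb
  · refine hst.antisymm fun a ha => ?_
    obtain ⟨b, hb, hab⟩ := hα.exists_comparable a
    have hb' : IsBasic b := (isBasic_iff_relBasic b).2 hb
    obtain rfl : a = b := hab.elim (ht.eq ha (hst hb')) (ht.eq' ha (hst hb'))
    exact hb'
end
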